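/- Let α > 0, let Y be a real random variable admitting a probability density θ with respect to Lebesgue measure, and let U be uniformly distributed on [0,1] and independent of Y. Then the random variable Y e^{−αU} admits the probability density θ̌ given for v ≠ 0 by θ̌(v) = (1/(αv)) ∫_v^{v e^α} θ(y) dy; that is, the law of Y e^{−αU} is the measure with Lebesgue density θ̌. -/

import Mathlib

open MeasureTheory Set ProbabilityTheory
open scoped ENNReal Real

noncomputable section

/-- The density `θ̌` of `Y e^{-αU}`: `θ̌(v) = (1/(αv)) ∫_v^{v e^α} θ(y) dy` (oriented
interval integral, so that `θ̌(v) ≥ 0` also for `v < 0`). -/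
def thetaCheck (α : ℝ) (θ : ℝ → ℝ) (v : ℝ) : ℝ :=
  (1 / (α * v)) * ∫ y in v..(v * Real.exp α), θ y

/-- Scaling substitution for the Lebesgue integral on `ℝ`. -/
theorem lintegral_eq_mul_lintegral_comp_mul_left {a : ℝ} (ha : a ≠ 0) {g : ℝ → ℝ≥0∞}
    (hg : Measurable g) :
    ∫⁻ y, g y = ENNReal.ofReal |a| * ∫⁻ v, g (a * v) := by
  conv_lhs => rw [← Real.smul_map_volume_mul_left ha]
  rw [lintegral_smul_measure, lintegral_map hg (measurable_const_mul a), smul_eq_mul]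

/-- The curve `u ↦ v e^{αu}` sweeps the interval between `v` and `v e^α`. -/
theorem image_mul_exp_Icc {α : ℝ} (hα : 0 < α) (v : ℝ) :
    (fun u => v * Real.exp (α * u)) '' Icc (0 : ℝ) 1 = uIcc v (v * Real.exp α) := by
  have himage : (fun u => Real.exp (α * u)) '' uIcc (0 : ℝ) 1 = uIcc 1 (Real.exp α) := by
    have hmono : Monotone fun u : ℝ => Real.exp (α * u) := fun a b hab =>
      Real.exp_le_exp.2 (mul_le_mul_of_nonneg_left hab hα.le)
    apply Subset.antisymm
    · simpa using (hmono.monotoneOn (uIcc (0 : ℝ) 1)).image_uIcc_subset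
    · have hcont : Continuous fun u : ℝ => Real.exp (α * u) := by fun_prop
      simpa using intermediate_value_uIcc (hcont.continuousOn (s := uIcc (0 : ℝ) 1))
  have hscale := Set.image_const_mul_uIcc v 1 (Real.exp α)
  rw [mul_one, ← himage, image_image, uIcc_of_le zero_le_one] at hscale
  exact hscale

/-- `θ̌` written with a set integral over the unordered interval. -/
theorem thetaCheck_eq_setIntegral {α : ℝ} (hα : 0 < α) (θ : ℝ → ℝ) {v : ℝ} (hv : v ≠ 0) :
    thetaCheck α θ v = |α * v|⁻¹ * ∫ y in uIcc v (v * Real.exp α), θ y := by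
  have hexp : 1 < Real.exp α := Real.one_lt_exp_iff.2 hα
  unfold thetaCheck
  rcases lt_or_gt_of_ne hv with hneg | hpos
  · have hle : v * Real.exp α ≤ v := by nlinarith
    rw [uIcc_of_ge hle, intervalIntegral.integral_of_ge hle, integral_Icc_eq_integral_Ioc,
      abs_of_neg (mul_neg_of_pos_of_neg hα hneg), inv_neg, one_div]
    ring
  · have hle : v ≤ v * Real.exp α := by nlinarith
    rw [uIcc_of_le hle, intervalIntegral.integral_of_le hle, integral_Icc_eq_integral_Ioc,
      abs_of_pos (mul_pos hα hpos), one_div]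

/-- Averaging the scaled densities `e^{αu} θ(e^{αu} v)` over `u ∈ [0,1]` gives `θ̌(v)`. -/
theorem setLIntegral_exp_mul_density {α : ℝ} (hα : 0 < α) {θ : ℝ → ℝ} (hmeas : Measurable θ)
    (hnonneg : ∀ y, 0 ≤ θ y) (hfin : ∫⁻ y : ℝ, ENNReal.ofReal (θ y) ≠ ∞) {v : ℝ} (hv : v ≠ 0) :
    ∫⁻ u in Icc (0 : ℝ) 1,
        ENNReal.ofReal (Real.exp (α * u)) * ENNReal.ofReal (θ (Real.exp (α * u) * v))
      = ENNReal.ofReal (thetaCheck α θ v) := by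
  have hint : Integrable θ := ⟨hmeas.aestronglyMeasurable, by
    rw [hasFiniteIntegral_iff_ofReal (Filter.Eventually.of_forall hnonneg)]
    exact hfin.lt_top⟩
  have hαv : α * v ≠ 0 := mul_ne_zero hα.ne' hv
  have hderiv : ∀ u ∈ Icc (0 : ℝ) 1, HasDerivWithinAt (fun u => v * Real.exp (α * u))
      (α * v * Real.exp (α * u)) (Icc 0 1) u := fun u _ => by
    have h : HasDerivAt (fun u => v * Real.exp (α * u)) (v * (Real.exp (α * u) * (α * 1))) u :=
      ((hasDerivAt_id u).const_mul α).exp.const_mul v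
    exact (h.congr_deriv (by ring)).hasDerivWithinAt
  have hinj : InjOn (fun u => v * Real.exp (α * u)) (Icc 0 1) := fun a _ b _ hab =>
    mul_left_cancel₀ hα.ne' (Real.exp_injective (mul_left_cancel₀ hv hab))
  rw [thetaCheck_eq_setIntegral hα θ hv, ENNReal.ofReal_mul (by positivity),
    ofReal_integral_eq_lintegral_ofReal hint.integrableOn (Filter.Eventually.of_forall hnonneg),
    ← image_mul_exp_Icc hα v,
    lintegral_image_eq_lintegral_abs_deriv_mul measurableSet_Icc hderiv hinj,
    ← lintegral_const_mul _ (by fun_prop)]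
  refine lintegral_congr fun u => ?_
  rw [← mul_assoc, ← ENNReal.ofReal_mul (inv_nonneg.2 (abs_nonneg _)), abs_mul (α * v), Real.abs_exp,
    inv_mul_cancel_left₀ (abs_ne_zero.2 hαv), mul_comm v]

/-- If `Y` has density `θ` and `U` is uniform on `[0,1]`, independent of `Y`, then
`Y e^{-αU}` has density `θ̌`. -/
theorem law_of_exponentially_damped_mark
    {Ω : Type*} [MeasurableSpace Ω] (P : Measure Ω) [IsProbabilityMeasure P]
    (α : ℝ) (hα : 0 < α)
    (θ : ℝ → ℝ) (hmeas : Measurable θ) (hnonneg : ∀ y, 0 ≤ θ y)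
    (hdens : ∫⁻ y : ℝ, ENNReal.ofReal (θ y) = 1)
    (Y U : Ω → ℝ) (hY : Measurable Y) (hU : Measurable U)
    (hYlaw : Measure.map Y P = volume.withDensity (fun y => ENNReal.ofReal (θ y)))
    (hUlaw : Measure.map U P = volume.restrict (Set.Icc (0 : ℝ) 1))
    (hindep : IndepFun Y U P) :
    Measure.map (fun ω => Y ω * Real.exp (-α * U ω)) P
      = volume.withDensity (fun v => ENNReal.ofReal (thetaCheck α θ v)) := by
  have hprod : Measure.map (fun ω => (Y ω, U ω)) P =
      (volume.withDensity fun y => ENNReal.ofReal (θ y)).prod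
        (volume.restrict (Icc (0 : ℝ) 1)) := by
    rw [← hYlaw, ← hUlaw]
    exact (indepFun_iff_map_prod_eq_prod_map_map hY.aemeasurable hU.aemeasurable).1 hindep
  have hdamp : Measurable fun p : ℝ × ℝ => p.1 * Real.exp (-α * p.2) := by fun_prop
  have hθ : Measurable fun y => ENNReal.ofReal (θ y) := hmeas.ennreal_ofReal
  ext A hA
  have hind : Measurable (A.indicator (1 : ℝ → ℝ≥0∞)) := measurable_one.indicator hA
  have hscale : ∀ u : ℝ,
      ∫⁻ y, ENNReal.ofReal (θ y) * A.indicator 1 (y * Real.exp (-α * u)) =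
        ∫⁻ v, A.indicator 1 v *
          (ENNReal.ofReal (Real.exp (α * u)) * ENNReal.ofReal (θ (Real.exp (α * u) * v))) := by
    intro u
    rw [lintegral_eq_mul_lintegral_comp_mul_left (Real.exp_pos (α * u)).ne' (by fun_prop),
      Real.abs_exp, ← lintegral_const_mul _ (by fun_prop)]
    refine lintegral_congr fun v => ?_
    have hcancel : Real.exp (α * u) * v * Real.exp (-α * u) = v := by
      rw [mul_right_comm, ← Real.exp_add]
      simp
    rw [hcancel]
    ring
  calc Measure.map (fun ω => Y ω * Real.exp (-α * U ω)) P A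
      = Measure.map (fun p : ℝ × ℝ => p.1 * Real.exp (-α * p.2))
          (Measure.map (fun ω => (Y ω, U ω)) P) A := by
        rw [Measure.map_map hdamp (hY.prodMk hU)]
        rfl
    _ = ∫⁻ x, A.indicator 1 x ∂(Measure.map (fun p : ℝ × ℝ => p.1 * Real.exp (-α * p.2))
          (Measure.map (fun ω => (Y ω, U ω)) P)) := (lintegral_indicator_one hA).symm
    _ = ∫⁻ u in Icc (0 : ℝ) 1,
          ∫⁻ y, ENNReal.ofReal (θ y) * A.indicator 1 (y * Real.exp (-α * u)) := by
        rw [lintegral_map hind hdamp, hprod,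
          lintegral_prod_symm' (fun p => A.indicator 1 (p.1 * Real.exp (-α * p.2)))
            (hind.comp hdamp)]
        refine lintegral_congr fun u => ?_
        rw [lintegral_withDensity_eq_lintegral_mul _ hθ (by fun_prop)]
        rfl
    _ = ∫⁻ v, A.indicator 1 v * ∫⁻ u in Icc (0 : ℝ) 1,
          ENNReal.ofReal (Real.exp (α * u)) * ENNReal.ofReal (θ (Real.exp (α * u) * v)) := by
        simp_rw [hscale]
        rw [lintegral_lintegral_swap (by unfold Function.uncurry; fun_prop)]
        refine lintegral_congr fun v => ?_
        rw [lintegral_const_mul _ (by fun_prop)]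
    _ = ∫⁻ v, A.indicator (fun v => ENNReal.ofReal (thetaCheck α θ v)) v := by
        refine lintegral_congr_ae ?_
        filter_upwards [Measure.ae_ne volume (0 : ℝ)] with v hv
        rw [setLIntegral_exp_mul_density hα hmeas hnonneg (by simp [hdens]) hv]
        by_cases hvA : v ∈ A <;> simp [hvA]
    _ = volume.withDensity (fun v => ENNReal.ofReal (thetaCheck α θ v)) A := by
        rw [lintegral_indicator hA, withDensity_apply _ hA]
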